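/- arXiv:1207.7332 — 2 statements merged into one kernel-verified Lean document; each statement's English description precedes it below -/
import Mathlib

section
/- Let n ≥ 2 be a natural number and let σ be a permutation of Fin n that is a product of a list of transpositions Equiv.swap i j with (j : ℕ) = (i : ℕ) + 2. Then σ has at least two orbits on Fin n; equivalently, there exist k, l : Fin n such that l does not lie in the orbit of k under the cyclic group generated by σ. In particular σ is not a single n-cycle. -/
/-- The subgroup of permutations of `α` that preserve every fiber of `f`. -/
def fiberPreserving {α β : Type*} (f : α → β) : Subgroup (Equiv.Perm α) where
  carrier := {σ | ∀ x, f (σ x) = f x}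
  one_mem' _ := rfl
  mul_mem' hσ hτ x := (hσ _).trans (hτ x)
  inv_mem' {σ} hσ x := by simpa using (hσ (σ⁻¹ x)).symm

theorem mem_fiberPreserving {α β : Type*} {f : α → β} {σ : Equiv.Perm α} :
    σ ∈ fiberPreserving f ↔ ∀ x, f (σ x) = f x :=
  Iff.rfl

theorem swap_mem_fiberPreserving {α β : Type*} [DecidableEq α] {f : α → β} {i j : α}
    (h : f i = f j) : Equiv.swap i j ∈ fiberPreserving f := by
  intro x
  rw [Equiv.swap_apply_def]
  split_ifs <;> simp_all

theorem eq_of_mem_orbit_zpowers {α β : Type*} {f : α → β} {σ : Equiv.Perm α}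
    (hσ : σ ∈ fiberPreserving f) {k m : α}
    (hm : m ∈ MulAction.orbit (Subgroup.zpowers σ) k) : f m = f k := by
  obtain ⟨⟨τ, hτ⟩, rfl⟩ := hm
  exact mem_fiberPreserving.1 ((Subgroup.zpowers_le.2 hσ) hτ) k

theorem triple_crossing_perm_not_transitive (n : ℕ) (hn : 2 ≤ n)
    (σ : Equiv.Perm (Fin n)) (l : List (Equiv.Perm (Fin n)))
    (hl : ∀ τ ∈ l, ∃ i j : Fin n, (j : ℕ) = (i : ℕ) + 2 ∧ τ = Equiv.swap i j)
    (hσ : σ = l.prod) :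
    ∃ k m : Fin n, m ∉ MulAction.orbit (Subgroup.zpowers σ) k := by
  have hmem : σ ∈ fiberPreserving fun x : Fin n => (x : ℕ) % 2 := by
    rw [hσ]
    refine Subgroup.list_prod_mem _ fun τ hτ => ?_
    obtain ⟨i, j, hij, rfl⟩ := hl τ hτ
    exact swap_mem_fiberPreserving (by simp [hij])
  refine ⟨⟨0, by omega⟩, ⟨1, by omega⟩, fun h => ?_⟩
  simpa using eq_of_mem_orbit_zpowers hmem h
end

section
/- Fix n ≥ 2 and let B_n be the presented group with generators s 1, …, s (n-1) and relations s i * s j = s j * s i whenever |i − j| ≥ 2, and s i * s (i+1) * s i = s (i+1) * s i * s (i+1) for 1 ≤ i ≤ n − 2 (the Artin braid group on n strings). Then the full twist (s 1 * s 2 * ⋯ * s (n-1))^n lies in the center of B_n: it commutes with every element of B_n. -/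
/-- The braid relators on `n` strings: commuting relators for far-apart generators
and the braid relators for adjacent generators, as elements of the free group on
the `n - 1` generators. -/
def braidRels (n : ℕ) : Set (FreeGroup (Fin (n - 1))) :=
  { r | (∃ i j : Fin (n - 1), (i : ℕ) + 2 ≤ (j : ℕ) ∧
          r = FreeGroup.of i * FreeGroup.of j * (FreeGroup.of j * FreeGroup.of i)⁻¹) ∨
        (∃ i j : Fin (n - 1), (j : ℕ) = (i : ℕ) + 1 ∧
          r = FreeGroup.of i * FreeGroup.of j * FreeGroup.of i *
              (FreeGroup.of j * FreeGroup.of i * FreeGroup.of j)⁻¹) }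

/-- Bundles the Artin relations for the first `m` terms of a sequence in a group. -/
structure IsBraidSequence {G : Type*} [Group G] (m : ℕ) (s : ℕ → G) : Prop where
  comm : ∀ i j, i + 2 ≤ j → j < m → s i * s j = s j * s i
  braid : ∀ i, i + 1 < m → s i * s (i + 1) * s i = s (i + 1) * s i * s (i + 1)

namespace IsBraidSequence

variable {G : Type*} [Group G] {m : ℕ} {s : ℕ → G}

theorem commute_prod_range (h : IsBraidSequence m s) {k j : ℕ} (hkj : k + 1 ≤ j) (hj : j < m) :
    Commute ((List.range k).map s).prod (s j) := by
  refine Commute.list_prod_left _ _ fun x hx => ?_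
  obtain ⟨i, hi, rfl⟩ := List.mem_map.1 hx
  exact h.comm i j (by have := List.mem_range.1 hi; omega) hj

theorem semiconjBy_prod_range (h : IsBraidSequence m s) {i k : ℕ} (hik : i + 2 ≤ k) (hk : k ≤ m) :
    SemiconjBy ((List.range k).map s).prod (s i) (s (i + 1)) := by
  induction k, hik using Nat.le_induction with
  | base =>
    have hc := (h.commute_prod_range (le_refl (i + 1)) (by omega)).eq
    have hb := h.braid i (by omega)
    simp only [List.range_succ, List.map_append, List.prod_append, List.map_cons, List.map_nil,
      List.prod_singleton, SemiconjBy]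
    simp only [mul_assoc] at hb ⊢
    rw [hb, ← mul_assoc, hc, mul_assoc]
  | succ k hik ih =>
    simp only [List.range_succ, List.map_append, List.prod_append, List.map_cons, List.map_nil,
      List.prod_singleton]
    exact (ih (by omega)).mul_left (h.comm i k hik (by omega)).symm

theorem semiconjBy_pow_prod_range (h : IsBraidSequence m s) {i : ℕ} (hi : i < m) :
    SemiconjBy (((List.range m).map s).prod ^ i) (s 0) (s i) := by
  induction i with
  | zero => simp
  | succ i ih =>
    rw [pow_succ']
    exact (h.semiconjBy_prod_range (by omega) le_rfl).mul_left (ih (by omega))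

theorem semiconjBy_sq_prod_range {p : ℕ} (h : IsBraidSequence (p + 1) s) :
    SemiconjBy (((List.range (p + 1)).map s).prod ^ 2) (s p) (s 0) := by
  have key : ∀ q ≤ p, SemiconjBy ((List.range (p + 1)).map s).prod
      ((List.range q).map s).prod ((List.range q).map fun i => s (i + 1)).prod := by
    intro q hq
    induction q with
    | zero => simp
    | succ q ih =>
      simp only [List.range_succ (n := q), List.map_append, List.prod_append, List.map_cons,
        List.map_nil, List.prod_singleton]
      exact (ih (by omega)).mul_right (h.semiconjBy_prod_range (by omega) le_rfl)
  have hfirst : ((List.range (p + 1)).map s).prod =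
      s 0 * ((List.range p).map fun i => s (i + 1)).prod := by
    simp [List.range_succ_eq_map, Function.comp_def]
  have hlast : ((List.range (p + 1)).map s).prod = ((List.range p).map s).prod * s p := by
    simp [List.range_succ]
  have hkey := (key p le_rfl).eq
  generalize ((List.range (p + 1)).map s).prod = d at *
  calc d ^ 2 * s p = d * d * s p := by rw [sq]
    _ = s 0 * (((List.range p).map fun i => s (i + 1)).prod * d) * s p := by
      nth_rewrite 1 [hfirst]; simp only [mul_assoc]
    _ = s 0 * (d * (((List.range p).map s).prod * s p)) := by rw [← hkey]; simp only [mul_assoc]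
    _ = s 0 * d ^ 2 := by rw [← hlast, sq]

theorem commute_full_twist (h : IsBraidSequence m s) {i : ℕ} (hi : i < m) :
    Commute (((List.range m).map s).prod ^ (m + 1)) (s i) := by
  obtain ⟨p, rfl⟩ : ∃ p, m = p + 1 := ⟨m - 1, by omega⟩
  have h0 : Commute (((List.range (p + 1)).map s).prod ^ (p + 1 + 1)) (s 0) := by
    have := h.semiconjBy_sq_prod_range.mul_left (h.semiconjBy_pow_prod_range (Nat.lt_succ_self p))
    rwa [← pow_add, show 2 + p = p + 1 + 1 by omega] at this
  have hs := h.semiconjBy_pow_prod_range hi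
  rw [← mul_inv_eq_iff_eq_mul.2 hs.eq]
  have hd := Commute.pow_pow_self ((List.range (p + 1)).map s).prod (p + 1 + 1) i
  exact (hd.mul_right h0).mul_right hd.inv_right

end IsBraidSequence

/-- The standard generators of the braid group, extended by `1` to all natural indices. -/
def braidGenerator (n i : ℕ) : PresentedGroup (braidRels n) :=
  if h : i < n - 1 then PresentedGroup.of ⟨i, h⟩ else 1

theorem braidGenerator_val {n : ℕ} (i : Fin (n - 1)) :
    braidGenerator n i = PresentedGroup.of i := by
  simp [braidGenerator]

theorem isBraidSequence_braidGenerator (n : ℕ) :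
    IsBraidSequence (n - 1) (braidGenerator n) where
  comm i j hij hj := by
    have hi : i < n - 1 := by omega
    simp only [braidGenerator, hi, hj, dite_true]
    have := PresentedGroup.one_of_mem (rels := braidRels n) (Or.inl ⟨⟨i, hi⟩, ⟨j, hj⟩, hij, rfl⟩)
    rwa [map_mul, map_inv, mul_inv_eq_one] at this
  braid i hj := by
    have hi : i < n - 1 := by omega
    simp only [braidGenerator, hi, hj, dite_true]
    have := PresentedGroup.one_of_mem (rels := braidRels n)
      (Or.inr ⟨⟨i, hi⟩, ⟨i + 1, hj⟩, rfl, rfl⟩)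
    rwa [map_mul, map_inv, mul_inv_eq_one] at this

theorem full_twist_central_in_braid_group (n : ℕ) (hn : 2 ≤ n) :
    ∀ g : PresentedGroup (braidRels n),
      ((List.ofFn fun i : Fin (n - 1) =>
          (PresentedGroup.of i : PresentedGroup (braidRels n))).prod ^ n) * g
        = g * ((List.ofFn fun i : Fin (n - 1) =>
          (PresentedGroup.of i : PresentedGroup (braidRels n))).prod ^ n) := by
  intro g
  have hlist : (List.ofFn fun i : Fin (n - 1) =>
      (PresentedGroup.of i : PresentedGroup (braidRels n))) =
      (List.range (n - 1)).map (braidGenerator n) := by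
    apply List.ext_getElem <;> simp +contextual [braidGenerator]
  rw [hlist]
  have hg : g ∈ Subgroup.closure
      (Set.range (PresentedGroup.of : Fin (n - 1) → PresentedGroup (braidRels n))) := by
    simp [PresentedGroup.closure_range_of]
  change Commute _ g
  induction hg using Subgroup.closure_induction with
  | mem x hx =>
    obtain ⟨i, rfl⟩ := hx
    have := (isBraidSequence_braidGenerator n).commute_full_twist i.isLt
    rwa [braidGenerator_val, Nat.sub_add_cancel (by omega)] at this
  | one => exact Commute.one_right _
  | mul x y _ _ hx hy => exact hx.mul_right hy
  | inv x _ hx => exact hx.inv_right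
end
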